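/- arXiv:2110.14544 — 8 statements merged into one kernel-verified Lean document; each statement's English description precedes it below -/
import Mathlib

section
/- Let (Ω, μ) be a probability space and γ : Fin n → Ω → ℝ a family of nonnegative measurable random variables. Let P_e : Fin n → ℝ be nonnegative, let Pmax ≥ P_e(f) for all f, let P ≥ 0, let P_u* : Fin n → ℝ satisfy P_u*(f) ≥ P for all f, and let r, ε ∈ ℝ. If μ{ω : ∑_f log₂(1 + γ(f)(ω)·P/(1 + γ(f)(ω)·Pmax)) ≤ r} ≤ ε, then μ{ω : ∑_f log₂(1 + γ(f)(ω)·P_u*(f)/(1 + γ(f)(ω)·P_e(f))) ≤ r} ≤ ε. -/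
open MeasureTheory

/-- The rate of a single channel increases with the useful power and decreases with the
interference power. -/
theorem logb_one_add_sinr_le {g p q a b : ℝ} (hg : 0 ≤ g) (hp : 0 ≤ p) (hpq : p ≤ q)
    (ha : 0 ≤ a) (hab : a ≤ b) :
    Real.logb 2 (1 + g * p / (1 + g * b)) ≤ Real.logb 2 (1 + g * q / (1 + g * a)) := by
  have hb : 0 ≤ b := ha.trans hab
  have hq : 0 ≤ q := hp.trans hpq
  apply Real.logb_le_logb_of_le one_lt_two (by positivity)
  gcongr

/-- core of Proposition 2: designing the power `P` against the
worst-case interference `Pmax` and then only raising the per-channel powers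
(to `P_u*`) preserves the reliability requirement `p ≤ ε`. -/
theorem feasible_allocation_preserves_reliability
    {Ω : Type*} [MeasurableSpace Ω] (μ : Measure Ω) [IsProbabilityMeasure μ]
    (n : ℕ) (γ : Fin n → Ω → ℝ)
    (hmeas : ∀ f, Measurable (γ f)) (hγ : ∀ f ω, 0 ≤ γ f ω)
    (Pe : Fin n → ℝ) (hPe : ∀ f, 0 ≤ Pe f)
    (Pmax : ℝ) (hPmax : ∀ f, Pe f ≤ Pmax)
    (P : ℝ) (hP : 0 ≤ P)
    (Pustar : Fin n → ℝ) (hPustar : ∀ f, P ≤ Pustar f)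
    (r ε : ℝ)
    (hfea : μ {ω | ∑ f, Real.logb 2 (1 + γ f ω * P / (1 + γ f ω * Pmax)) ≤ r}
      ≤ ENNReal.ofReal ε) :
    μ {ω | ∑ f, Real.logb 2 (1 + γ f ω * Pustar f / (1 + γ f ω * Pe f)) ≤ r}
      ≤ ENNReal.ofReal ε := by
  refine (measure_mono fun ω hω => ?_).trans hfea
  exact (Finset.sum_le_sum fun f _ =>
    logb_one_add_sinr_le (hγ f ω) hP (hPustar f) (hPe f) (hPmax f)).trans hω
end

section
/- Let γ be a real random variable with exponential distribution of mean Γ > 0, let P > 0, P_e ≥ 0 and r > 0. If P > (2^r − 1)·P_e, then Pr{log₂(1 + γ·P/(1 + γ·P_e)) ≤ r} = 1 − exp(−(2^r − 1)/(Γ·(P − (2^r − 1)·P_e))). If instead P ≤ (2^r − 1)·P_e, then Pr{log₂(1 + γ·P/(1 + γ·P_e)) ≤ r} = 1. -/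
open MeasureTheory Real

/-- A real function whose distribution function vanishes on the negative reals is almost everywhere
nonnegative; no measurability is needed. -/
lemma ae_nonneg_of_measure_le_eq_zero {Ω : Type*} [MeasurableSpace Ω] {μ : Measure Ω} {γ : Ω → ℝ}
    (h : ∀ x : ℝ, x < 0 → μ {ω | γ ω ≤ x} = 0) : ∀ᵐ ω ∂μ, 0 ≤ γ ω := by
  have hall : ∀ᵐ ω ∂μ, ∀ n : ℕ, -(1 / ((n : ℝ) + 1)) < γ ω := by
    refine ae_all_iff.2 fun n => ?_
    simpa only [ae_iff, not_lt] using h _ (neg_neg_of_pos Nat.one_div_pos_of_nat)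
  filter_upwards [hall] with ω hω
  by_contra! hneg
  obtain ⟨n, hn⟩ := exists_nat_one_div_lt (neg_pos.2 hneg)
  linarith [hω n]

/-- For a nonnegative SNR, the outage condition is a linear inequality. -/
lemma logb_one_add_div_le_iff {g P Pe r : ℝ} (hg : 0 ≤ g) (hP : 0 < P) (hPe : 0 ≤ Pe) :
    Real.logb 2 (1 + g * P / (1 + g * Pe)) ≤ r ↔
      g * (P - ((2 : ℝ) ^ r - 1) * Pe) ≤ (2 : ℝ) ^ r - 1 := by
  have hden : 0 < 1 + g * Pe := by positivity
  rw [Real.logb_le_iff_le_rpow one_lt_two (by positivity), ← le_sub_iff_add_le', div_le_iff₀ hden]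
  constructor <;> intro h <;> linarith

/-- closed-form single-frequency outage probability under
Rayleigh fading (exponential SNR of mean `Γ`) with interference `Pe`. -/
theorem single_frequency_outage_probability
    {Ω : Type*} [MeasurableSpace Ω] (μ : Measure Ω) [IsProbabilityMeasure μ]
    (γ : Ω → ℝ) (Γ : ℝ) (hΓ : 0 < Γ)
    (hcdf : ∀ x : ℝ, 0 ≤ x → μ {ω | γ ω ≤ x} = ENNReal.ofReal (1 - Real.exp (-x / Γ)))
    (hcdf_neg : ∀ x : ℝ, x < 0 → μ {ω | γ ω ≤ x} = 0)
    (P Pe r : ℝ) (hP : 0 < P) (hPe : 0 ≤ Pe) (hr : 0 < r) :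
    (((2 : ℝ) ^ r - 1) * Pe < P →
      μ {ω | Real.logb 2 (1 + γ ω * P / (1 + γ ω * Pe)) ≤ r} =
        ENNReal.ofReal
          (1 - Real.exp (-((2 : ℝ) ^ r - 1) / (Γ * (P - ((2 : ℝ) ^ r - 1) * Pe))))) ∧
    (P ≤ ((2 : ℝ) ^ r - 1) * Pe →
      μ {ω | Real.logb 2 (1 + γ ω * P / (1 + γ ω * Pe)) ≤ r} = 1) := by
  have hk : 0 < (2 : ℝ) ^ r - 1 := sub_pos.2 (Real.one_lt_rpow one_lt_two hr)
  have hnonneg := ae_nonneg_of_measure_le_eq_zero hcdf_neg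
  refine ⟨fun h => ?_, fun h => ?_⟩
  · have hd : 0 < P - ((2 : ℝ) ^ r - 1) * Pe := sub_pos.2 h
    have hae : {ω | Real.logb 2 (1 + γ ω * P / (1 + γ ω * Pe)) ≤ r} =ᵐ[μ]
        {ω | γ ω ≤ ((2 : ℝ) ^ r - 1) / (P - ((2 : ℝ) ^ r - 1) * Pe)} := by
      refine Filter.eventuallyEq_set.2 ?_
      filter_upwards [hnonneg] with ω hω
      rw [logb_one_add_div_le_iff hω hP hPe, le_div_iff₀ hd]
    rw [measure_congr hae, hcdf _ (div_nonneg hk.le hd.le),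
      ← neg_div, div_div, mul_comm Γ]
  · have hae : {ω | Real.logb 2 (1 + γ ω * P / (1 + γ ω * Pe)) ≤ r} =ᵐ[μ] Set.univ := by
      refine Filter.eventuallyEq_set.2 ?_
      filter_upwards [hnonneg] with ω hω
      rw [logb_one_add_div_le_iff hω hP hPe]
      exact iff_of_true ((mul_nonpos_of_nonneg_of_nonpos hω (sub_nonpos.2 h)).trans hk.le) trivial
    rw [measure_congr hae, measure_univ]
end

section
/- Let γ be a real random variable with exponential distribution of mean Γ > 0, let P_e ≥ 0, r > 0, and 0 < ε < 1. Define P* = (2^r − 1)·(P_e − 1/(Γ·ln(1 − ε))). Then P* > (2^r − 1)·P_e, the outage probability at P* equals the target exactly: Pr{log₂(1 + γ·P*/(1 + γ·P_e)) ≤ r} = ε, and P* is minimal: every P ≥ 0 with Pr{log₂(1 + γ·P/(1 + γ·P_e)) ≤ r} ≤ ε satisfies P ≥ P*. -/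
open MeasureTheory Real

/-- For a positive channel gain, the rate falls short of `r` exactly when the gain times the excess
power is at most the SINR threshold `2 ^ r - 1`. -/
lemma logb_one_add_sinr_le_iff {g P Pe r : ℝ} (hg : 0 < g) (hP : 0 ≤ P) (hPe : 0 ≤ Pe) :
    Real.logb 2 (1 + g * P / (1 + g * Pe)) ≤ r ↔
      g * (P - ((2 : ℝ) ^ r - 1) * Pe) ≤ (2 : ℝ) ^ r - 1 := by
  have hden : 0 < 1 + g * Pe := by positivity
  have hsinr : 0 < 1 + g * P / (1 + g * Pe) := by positivity
  rw [Real.logb_le_iff_le_rpow one_lt_two hsinr, ← le_sub_iff_add_le', div_le_iff₀ hden]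
  constructor <;> intro h <;> linarith

/-- The outage event agrees almost surely with a linear condition on an almost surely positive
channel gain. -/
lemma measure_outage_eq {Ω : Type*} [MeasurableSpace Ω] {μ : Measure Ω} {γ : Ω → ℝ}
    (hγ : ∀ᵐ ω ∂μ, 0 < γ ω) {P Pe : ℝ} (r : ℝ) (hP : 0 ≤ P) (hPe : 0 ≤ Pe) :
    μ {ω | Real.logb 2 (1 + γ ω * P / (1 + γ ω * Pe)) ≤ r} =
      μ {ω | γ ω * (P - ((2 : ℝ) ^ r - 1) * Pe) ≤ (2 : ℝ) ^ r - 1} := by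
  refine measure_congr ?_
  filter_upwards [hγ] with ω hω
  exact propext (logb_one_add_sinr_le_iff hω hP hPe)

/-- equation (24) of the paper: the closed-form power
`P* = (2^r − 1)(P_e − 1/(Γ ln(1−ε)))` meets the single-frequency outage
target exactly and is the minimal power doing so. -/
theorem single_frequency_optimal_power
    {Ω : Type*} [MeasurableSpace Ω] (μ : Measure Ω) [IsProbabilityMeasure μ]
    (γ : Ω → ℝ) (Γ : ℝ) (hΓ : 0 < Γ)
    (hcdf : ∀ x : ℝ, 0 ≤ x → μ {ω | γ ω ≤ x} = ENNReal.ofReal (1 - Real.exp (-x / Γ)))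
    (hcdf_neg : ∀ x : ℝ, x < 0 → μ {ω | γ ω ≤ x} = 0)
    (Pe r ε : ℝ) (hPe : 0 ≤ Pe) (hr : 0 < r) (hε : 0 < ε) (hε1 : ε < 1)
    (Pstar : ℝ)
    (hPstar : Pstar = ((2 : ℝ) ^ r - 1) * (Pe - 1 / (Γ * Real.log (1 - ε)))) :
    ((2 : ℝ) ^ r - 1) * Pe < Pstar ∧
    μ {ω | Real.logb 2 (1 + γ ω * Pstar / (1 + γ ω * Pe)) ≤ r} = ENNReal.ofReal ε ∧
    (∀ P : ℝ, 0 ≤ P →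
      μ {ω | Real.logb 2 (1 + γ ω * P / (1 + γ ω * Pe)) ≤ r} ≤ ENNReal.ofReal ε →
      Pstar ≤ P) := by
  have hpos : ∀ᵐ ω ∂μ, 0 < γ ω := by
    have h0 : μ {ω | γ ω ≤ 0} = 0 := by simpa using hcdf 0 le_rfl
    simpa [ae_iff] using h0
  have hc : 0 < (2 : ℝ) ^ r - 1 := sub_pos.2 (Real.one_lt_rpow one_lt_two hr)
  have houtage : ∀ P : ℝ, 0 ≤ P → ((2 : ℝ) ^ r - 1) * Pe < P →
      μ {ω | Real.logb 2 (1 + γ ω * P / (1 + γ ω * Pe)) ≤ r} =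
        ENNReal.ofReal
          (1 - Real.exp (-(((2 : ℝ) ^ r - 1) / (P - ((2 : ℝ) ^ r - 1) * Pe)) / Γ)) := by
    intro P hP hlt
    have hd : 0 < P - ((2 : ℝ) ^ r - 1) * Pe := sub_pos.2 hlt
    rw [measure_outage_eq hpos r hP hPe, ← hcdf _ (div_pos hc hd).le]
    simp only [le_div_iff₀ hd]
  set c := (2 : ℝ) ^ r - 1
  have hlog : Real.log (1 - ε) < 0 := Real.log_neg (by linarith) (by linarith)
  have hexp : Real.exp (Real.log (1 - ε)) = 1 - ε := Real.exp_log (by linarith)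
  set L := Real.log (1 - ε)
  have hΓL : 0 < Γ * -L := mul_pos hΓ (neg_pos.2 hlog)
  have hdiff : Pstar - c * Pe = c / (Γ * -L) := by
    rw [hPstar, mul_neg, div_neg]
    ring
  have hlt : c * Pe < Pstar := sub_pos.1 (hdiff ▸ div_pos hc hΓL)
  have hPstar_nonneg : 0 ≤ Pstar := (mul_nonneg hc.le hPe).trans hlt.le
  refine ⟨hlt, ?_, fun P hP hout => ?_⟩
  · have harg : -(c / (c / (Γ * -L))) / Γ = L := by
      rw [div_div_cancel₀ hc.ne']
      field_simp
    rw [houtage Pstar hPstar_nonneg hlt, hdiff, harg, hexp, sub_sub_cancel]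
  · rcases le_or_gt P (c * Pe) with hle | hgt
    · have hone : μ {ω | Real.logb 2 (1 + γ ω * P / (1 + γ ω * Pe)) ≤ r} = 1 := by
        rw [measure_outage_eq hpos r hP hPe, ← measure_univ (μ := μ)]
        refine measure_congr ?_
        filter_upwards [hpos] with ω hω
        refine propext (iff_true_intro ?_)
        exact (mul_nonpos_of_nonneg_of_nonpos hω.le (sub_nonpos.2 hle)).trans hc.le
      rw [hone, ENNReal.one_le_ofReal] at hout
      linarith
    · have hd : 0 < P - c * Pe := sub_pos.2 hgt
      rw [houtage P hP hgt, ENNReal.ofReal_le_ofReal_iff hε.le, sub_le_comm, ← hexp,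
        Real.exp_le_exp, le_div_iff₀ hΓ] at hout
      have hthreshold : c / (P - c * Pe) ≤ Γ * -L := by linarith
      have hexcess : c / (Γ * -L) ≤ P - c * Pe := (div_le_comm₀ hd hΓL).1 hthreshold
      linarith
end

section
/- Let n ≥ 1, let c : Fin n → ℝ be strictly positive, let r ∈ ℝ, and set μ = 2^r · (∏_f c(f))^{1/n}. Assume μ ≥ c(f) for every f. Define x(f) = μ − c(f). Then x(f) ≥ 0 for all f, the constraint is met with equality: ∑_f log₂(1 + x(f)/c(f)) = n·r, and x is optimal: every y : Fin n → ℝ with y(f) ≥ 0 for all f and ∑_f log₂(1 + y(f)/c(f)) ≥ n·r satisfies ∑_f y(f) ≥ ∑_f x(f) = n·μ − ∑_f c(f). -/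
open Real

/-- The tangent-line bound for the logarithm at the water level `m`, in terms of a channel rate. -/
theorem log_one_add_div_le {c m y : ℝ} (hc : 0 < c) (hm : 0 < m) (hy : 0 ≤ y) :
    log (1 + y / c) ≤ log m - log c + (y - (m - c)) / m := by
  have hcy : 0 < c + y := by linarith
  have h₁ : 1 + y / c = (c + y) / c := by field_simp
  have h₂ : (y - (m - c)) / m = (c + y) / m - 1 := by field_simp; ring
  have h₃ := log_le_sub_one_of_pos (div_pos hcy hm)
  rw [log_div hcy.ne' hm.ne'] at h₃
  rw [h₁, h₂, log_div hcy.ne' hc.ne']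
  linarith

/-- water-filling solution with all channels active.  With water
level `m = 2^r (∏ c f)^{1/n}` and powers `x f = m − c f`, the rate constraint
is met with equality and `x` minimizes the total power among all feasible
nonnegative vectors. -/
theorem waterfilling_all_active_optimal
    (n : ℕ) (hn : 1 ≤ n)
    (c : Fin n → ℝ) (hc : ∀ f, 0 < c f)
    (r : ℝ) (m : ℝ)
    (hm : m = (2 : ℝ) ^ r * (∏ f, c f) ^ ((1 : ℝ) / n))
    (hactive : ∀ f, c f ≤ m)
    (x : Fin n → ℝ) (hx : ∀ f, x f = m - c f) :
    (∀ f, 0 ≤ x f) ∧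
    (∑ f, Real.logb 2 (1 + x f / c f) = n * r) ∧
    (∀ y : Fin n → ℝ, (∀ f, 0 ≤ y f) →
      (n : ℝ) * r ≤ ∑ f, Real.logb 2 (1 + y f / c f) →
      ∑ f, x f ≤ ∑ f, y f) ∧
    ∑ f, x f = n * m - ∑ f, c f := by
  have hn₀ : (n : ℝ) ≠ 0 := by positivity
  have hP : 0 < ∏ f, c f := Finset.prod_pos fun f _ => hc f
  have hm₀ : 0 < m := hm ▸ by positivity
  have hlog2 : 0 < log 2 := log_pos one_lt_two
  have hlogm : n * log m - ∑ f, log (c f) = n * r * log 2 := by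
    rw [hm, log_mul (by positivity) (by positivity), log_rpow two_pos, log_rpow hP,
      log_prod fun f _ => (hc f).ne']
    field_simp
    ring
  have hrate (y : Fin n → ℝ) :
      ∑ f, logb 2 (1 + y f / c f) = (∑ f, log (1 + y f / c f)) / log 2 := by
    simp only [logb, Finset.sum_div]
  refine ⟨fun f => by rw [hx]; linarith [hactive f], ?_, fun y hy hr => ?_, ?_⟩
  · have hterm (f : Fin n) : log (1 + x f / c f) = log m - log (c f) := by
      have hcf := (hc f).ne'
      rw [← log_div hm₀.ne' hcf, hx]
      congr 1
      field_simp
      ring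
    rw [hrate, div_eq_iff hlog2.ne', ← hlogm]
    simp [hterm]
  · rw [hrate, le_div_iff₀ hlog2, ← hlogm] at hr
    have hle := Finset.sum_le_sum fun f (_ : f ∈ Finset.univ) =>
      log_one_add_div_le (hc f) hm₀ (hy f)
    simp only [← hx, Finset.sum_add_distrib, ← Finset.sum_div] at hle
    have hsum : ∑ f, (log m - log (c f)) = n * log m - ∑ f, log (c f) := by simp
    rw [hsum, Finset.sum_sub_distrib] at hle
    have hnonneg : 0 ≤ (∑ f, y f - ∑ f, x f) / m := by linarith
    rw [le_div_iff₀ hm₀, zero_mul] at hnonneg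
    linarith
  · simp [hx]
end

section
/- Let n ≥ 1, let c : Fin n → ℝ be strictly positive, let ν > 0, and define the water-filling vector x(f) = max(0, ν − c(f)). Then for every y : Fin n → ℝ with y(f) ≥ 0 for all f and ∑_f log₂(1 + y(f)/c(f)) ≥ ∑_f log₂(1 + x(f)/c(f)), one has ∑_f y(f) ≥ ∑_f x(f). In other words, among all nonnegative power vectors attaining at least the same total rate, the water-filling vector has minimal total power. -/
open Real

/-- Tangent-line bound for a single channel: the marginal power per nat of rate at the water-filling
point is at least `ν`. -/
lemma mul_log_sub_log_le_sub_waterfilling {c ν y : ℝ} (hc : 0 < c) (hν : 0 ≤ ν) (hy : 0 ≤ y) :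
    ν * (Real.log (1 + y / c) - Real.log (1 + max 0 (ν - c) / c)) ≤ y - max 0 (ν - c) := by
  set x := max 0 (ν - c) with hx
  have hx0 : 0 ≤ x := le_max_left _ _
  have hcx : 0 < c + x := by positivity
  have hlog : Real.log (1 + y / c) - Real.log (1 + x / c) ≤ (y - x) / (c + x) := by
    rw [← Real.log_div (by positivity) (by positivity)]
    refine (Real.log_le_sub_one_of_pos (by positivity)).trans_eq ?_
    field_simp
    ring
  refine (mul_le_mul_of_nonneg_left hlog hν).trans ?_
  rw [← mul_div_assoc, div_le_iff₀ hcx]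
  rcases le_total c ν with h | h
  · rw [max_eq_right (sub_nonneg.2 h)] at hx
    rw [hx]
    exact le_of_eq (by ring)
  · rw [max_eq_left (sub_nonpos.2 h)] at hx
    rw [hx, sub_zero, add_zero, mul_comm]
    exact mul_le_mul_of_nonneg_left h hy

/-- general water-filling optimality (possibly inactive
channels): with water level `ν`, the vector `x f = max 0 (ν − c f)` has
minimal total power among all nonnegative vectors attaining at least the
same total rate. -/
theorem waterfilling_optimal
    (n : ℕ) (hn : 1 ≤ n)
    (c : Fin n → ℝ) (hc : ∀ f, 0 < c f)
    (ν : ℝ) (hν : 0 < ν)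
    (x : Fin n → ℝ) (hx : ∀ f, x f = max 0 (ν - c f)) :
    ∀ y : Fin n → ℝ, (∀ f, 0 ≤ y f) →
      (∑ f, Real.logb 2 (1 + x f / c f)) ≤ ∑ f, Real.logb 2 (1 + y f / c f) →
      ∑ f, x f ≤ ∑ f, y f := by
  intro y hy hrate
  simp only [Real.logb, ← Finset.sum_div] at hrate
  rw [div_le_div_iff_of_pos_right (Real.log_pos one_lt_two)] at hrate
  have hchannel : ∀ f, ν * (Real.log (1 + y f / c f) - Real.log (1 + x f / c f)) ≤ y f - x f := by
    intro f
    rw [hx f]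
    exact mul_log_sub_log_le_sub_waterfilling (hc f) hν.le (hy f)
  have hsum := Finset.sum_le_sum fun f (_ : f ∈ Finset.univ) => hchannel f
  rw [← Finset.mul_sum, Finset.sum_sub_distrib, Finset.sum_sub_distrib] at hsum
  exact sub_nonneg.1 ((mul_nonneg hν.le (sub_nonneg.2 hrate)).trans hsum)
end

section
/- Let n ≥ 1 and r ∈ ℝ, and for a strictly positive vector c : Fin n → ℝ define the water level μ(c) = 2^r · (∏_f c(f))^{1/n} and the total water-filling power g(c) = n·μ(c) − ∑_f c(f). Let c, c' : Fin n → ℝ be strictly positive with c(f) ≤ c'(f) for all f, and assume μ(c) ≥ c(f) for all f and μ(c') ≥ c'(f) for all f. Then g(c) ≤ g(c'), i.e. the minimal total power of the water-filling solution is non-decreasing in the per-channel costs. -/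
open Real

/-- The secant slope of a convex function is monotone in both endpoints. -/
lemma ConvexOn.sub_mul_sub_le_sub_mul_sub {f : ℝ → ℝ} (hf : ConvexOn ℝ Set.univ f)
    {x x' m m' : ℝ} (hx : x ≤ x') (hm : m < m') (hxm : x ≤ m) (hxm' : x' ≤ m') :
    (f x' - f x) * (m' - m) ≤ (f m' - f m) * (x' - x) := by
  rcases hx.eq_or_lt with rfl | hx
  · simp
  have h₁ := hf.secant_mono (Set.mem_univ x) (Set.mem_univ x') (Set.mem_univ m') hx.ne'
    (by linarith) hxm'
  have h₂ := hf.secant_mono (Set.mem_univ m') (Set.mem_univ x) (Set.mem_univ m)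
    (by linarith) hm.ne hxm
  rw [← neg_div_neg_eq, ← neg_div_neg_eq (f m - f m')] at h₂
  simp only [neg_sub] at h₂
  exact (div_le_div_iff₀ (by linarith) (by linarith)).1 (h₁.trans h₂)

/-- The water level in logarithmic coordinates. -/
lemma two_rpow_mul_prod_rpow_eq_exp {n : ℕ} (r : ℝ) {c : Fin n → ℝ} (hc : ∀ f, 0 < c f) :
    (2 : ℝ) ^ r * (∏ g, c g) ^ ((1 : ℝ) / n) =
      exp (log 2 * r + (∑ f, log (c f)) * (1 / n)) := by
  rw [exp_add, rpow_def_of_pos two_pos, rpow_def_of_pos (Finset.prod_pos fun f _ => hc f),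
    log_prod fun f _ => (hc f).ne']

/-- the minimal total water-filling power
`g(c) = n·μ(c) − ∑ c f` with water level `μ(c) = 2^r (∏ c f)^{1/n}` is
non-decreasing in the per-channel costs (when all channels are active for
both cost vectors). -/
theorem waterfilling_power_monotone_in_costs
    (n : ℕ) (hn : 1 ≤ n) (r : ℝ)
    (c c' : Fin n → ℝ) (hc : ∀ f, 0 < c f) (hc' : ∀ f, 0 < c' f)
    (hle : ∀ f, c f ≤ c' f)
    (hactive : ∀ f, c f ≤ (2 : ℝ) ^ r * (∏ g, c g) ^ ((1 : ℝ) / n))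
    (hactive' : ∀ f, c' f ≤ (2 : ℝ) ^ r * (∏ g, c' g) ^ ((1 : ℝ) / n)) :
    (n : ℝ) * ((2 : ℝ) ^ r * (∏ g, c g) ^ ((1 : ℝ) / n)) - ∑ f, c f ≤
      (n : ℝ) * ((2 : ℝ) ^ r * (∏ g, c' g) ^ ((1 : ℝ) / n)) - ∑ f, c' f := by
  have hn₀ : (0 : ℝ) < n := by exact_mod_cast hn
  have hlog : ∀ f, log (c f) ≤ log (c' f) := fun f => log_le_log (hc f) (hle f)
  rw [two_rpow_mul_prod_rpow_eq_exp r hc] at hactive ⊢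
  rw [two_rpow_mul_prod_rpow_eq_exp r hc'] at hactive' ⊢
  set m := log 2 * r + (∑ f, log (c f)) * (1 / n) with hm
  set m' := log 2 * r + (∑ f, log (c' f)) * (1 / n) with hm'
  have hsum : ∑ f, (log (c' f) - log (c f)) = n * (m' - m) := by
    rw [Finset.sum_sub_distrib, hm, hm']
    field_simp
    ring
  have hmm : m ≤ m' := by
    have : 0 ≤ n * (m' - m) := hsum ▸ Finset.sum_nonneg fun f _ => sub_nonneg.2 (hlog f)
    exact sub_nonneg.1 (nonneg_of_mul_nonneg_right this hn₀)
  rcases hmm.eq_or_lt with heq | hlt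
  · rw [heq, sub_self, mul_zero,
      Finset.sum_eq_zero_iff_of_nonneg fun f _ => sub_nonneg.2 (hlog f)] at hsum
    have hcc : c = c' := funext fun f =>
      log_injOn_pos (hc f) (hc' f) (sub_eq_zero.1 (hsum f (Finset.mem_univ f))).symm
    rw [heq, hcc]
  · have hsecant : ∀ f, (c' f - c f) * (m' - m) ≤
        (exp m' - exp m) * (log (c' f) - log (c f)) := fun f => by
      have h := convexOn_exp.sub_mul_sub_le_sub_mul_sub (hlog f) hlt
        ((log_le_iff_le_exp (hc f)).2 (hactive f)) ((log_le_iff_le_exp (hc' f)).2 (hactive' f))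
      rwa [exp_log (hc f), exp_log (hc' f)] at h
    have h := Finset.sum_le_sum fun f (_ : f ∈ Finset.univ) => hsecant f
    rw [← Finset.sum_mul, ← Finset.mul_sum, hsum, ← mul_assoc, Finset.sum_sub_distrib] at h
    linarith [le_of_mul_le_mul_right h (sub_pos.2 hlt)]
end

section
/- Let n ≥ 1, let γ : Fin n → ℝ be strictly positive (the known eMBB channel SNRs), let P_e : Fin n → ℝ be nonnegative (the eMBB powers), and let r ∈ ℝ. Set c(f) = 1/γ(f) + P_e(f) and μ = 2^r · (∏_f c(f))^{1/n}, and assume μ ≥ c(f) for all f. Define x(f) = μ − c(f). Then x(f) ≥ 0 for all f, ∑_f log₂(1 + γ(f)·x(f)/(1 + γ(f)·P_e(f))) = n·r, and for every y : Fin n → ℝ with y(f) ≥ 0 for all f and ∑_f log₂(1 + γ(f)·y(f)/(1 + γ(f)·P_e(f))) ≥ n·r, one has ∑_f y(f) ≥ ∑_f x(f). -/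
open Real

/-- The rate of a stream of power `p` over interference `q` in terms of the cost `1 / g + q`. -/
lemma logb_one_add_snr {g q p : ℝ} (hg : 0 < g) (hq : 0 ≤ q) (hp : 0 ≤ p) :
    Real.logb 2 (1 + g * p / (1 + g * q)) =
      Real.logb 2 (1 / g + q + p) - Real.logb 2 (1 / g + q) := by
  have hcost : 0 < 1 / g + q := by positivity
  rw [← Real.logb_div (by positivity) hcost.ne']
  congr 1
  field_simp

/-- The tangent-line bound for the binary logarithm. -/
lemma logb_two_le_tangent {a m : ℝ} (ha : 0 < a) (hm : 0 < m) :
    Real.logb 2 a ≤ Real.logb 2 m + (a - m) / (m * Real.log 2) := by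
  have hlog : 0 < Real.log 2 := Real.log_pos one_lt_two
  have h := Real.log_le_sub_one_of_pos (div_pos ha hm)
  rw [Real.log_div ha.ne' hm.ne'] at h
  have hdiff := div_le_div_of_nonneg_right h hlog.le
  have heq : (a / m - 1) / Real.log 2 = (a - m) / (m * Real.log 2) := by
    field_simp
  rw [heq, sub_div] at hdiff
  simp only [Real.logb]
  linarith

/-- SIC power allocation, eq. (18): with costs
`c f = 1/γ f + P_e f` and water level `m = 2^r (∏ c f)^{1/n}` (all channels
active), the powers `x f = m − c f` are nonnegative, meet the SIC rate
constraint with equality, and minimize the total power. -/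
theorem sic_waterfilling_optimal
    (n : ℕ) (hn : 1 ≤ n)
    (γ : Fin n → ℝ) (hγ : ∀ f, 0 < γ f)
    (Pe : Fin n → ℝ) (hPe : ∀ f, 0 ≤ Pe f)
    (r : ℝ)
    (c : Fin n → ℝ) (hc : ∀ f, c f = 1 / γ f + Pe f)
    (m : ℝ) (hm : m = (2 : ℝ) ^ r * (∏ f, c f) ^ ((1 : ℝ) / n))
    (hactive : ∀ f, c f ≤ m)
    (x : Fin n → ℝ) (hx : ∀ f, x f = m - c f) :
    (∀ f, 0 ≤ x f) ∧
    (∑ f, Real.logb 2 (1 + γ f * x f / (1 + γ f * Pe f)) = n * r) ∧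
    (∀ y : Fin n → ℝ, (∀ f, 0 ≤ y f) →
      (n : ℝ) * r ≤ ∑ f, Real.logb 2 (1 + γ f * y f / (1 + γ f * Pe f)) →
      ∑ f, x f ≤ ∑ f, y f) := by
  have hcpos : ∀ f, 0 < c f := fun f => by
    have := hγ f
    have := hPe f
    rw [hc]
    positivity
  have hprod : 0 < ∏ f, c f := Finset.prod_pos fun f _ => hcpos f
  have hmpos : 0 < m := by
    rw [hm]
    positivity
  have hn0 : (n : ℝ) ≠ 0 := by positivity
  have hlogm : n * Real.logb 2 m = n * r + ∑ f, Real.logb 2 (c f) := by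
    rw [hm, Real.logb_mul (by positivity) (by positivity),
      Real.logb_rpow two_pos (by norm_num), Real.logb_rpow_eq_mul_logb_of_pos hprod,
      Real.logb_prod _ _ fun f _ => (hcpos f).ne']
    field_simp
  have hrate : ∀ y : Fin n → ℝ, (∀ f, 0 ≤ y f) →
      ∑ f, Real.logb 2 (1 + γ f * y f / (1 + γ f * Pe f)) =
        ∑ f, Real.logb 2 (c f + y f) - ∑ f, Real.logb 2 (c f) := by
    intro y hy
    rw [← Finset.sum_sub_distrib]
    refine Finset.sum_congr rfl fun f _ => ?_
    rw [logb_one_add_snr (hγ f) (hPe f) (hy f), hc]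
  have hx0 : ∀ f, 0 ≤ x f := fun f => by
    rw [hx]
    exact sub_nonneg.2 (hactive f)
  refine ⟨hx0, ?_, fun y hy hsum => ?_⟩
  · rw [hrate x hx0]
    simp only [hx, add_sub_cancel, Finset.sum_const, Finset.card_univ, Fintype.card_fin,
      nsmul_eq_mul]
    linarith
  · rw [hrate y hy] at hsum
    have htangent := Finset.sum_le_sum fun f (_ : f ∈ Finset.univ) =>
      logb_two_le_tangent (add_pos_of_pos_of_nonneg (hcpos f) (hy f)) hmpos
    rw [Finset.sum_add_distrib, ← Finset.sum_div] at htangent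
    simp only [Finset.sum_const, Finset.card_univ, Fintype.card_fin, nsmul_eq_mul] at htangent
    have hscale : 0 < m * Real.log 2 := mul_pos hmpos (Real.log_pos one_lt_two)
    have hgap : 0 ≤ (∑ f, (c f + y f - m)) / (m * Real.log 2) := by linarith
    have hgap' : 0 ≤ ∑ f, (c f + y f - m) := by
      rwa [le_div_iff₀ hscale, zero_mul] at hgap
    have hdiff : ∑ f, (c f + y f - m) = ∑ f, y f - ∑ f, x f := by
      rw [← Finset.sum_sub_distrib]
      refine Finset.sum_congr rfl fun f _ => ?_
      rw [hx]
      ring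
    linarith
end

section
/- Let n ≥ 1, let f : (Fin n → ℝ) → ℝ be continuous and antitone with respect to the componentwise order (x ≼ y implies f(y) ≤ f(x)), let b : Fin n → ℝ, and let ε ∈ ℝ. Define the feasible set S = {x : Fin n → ℝ | b(i) ≤ x(i) for all i, and f(x) ≤ ε}. Suppose x* ∈ S minimizes the total power: ∑_i x*(i) ≤ ∑_i y(i) for all y ∈ S. If f(x*) < ε, then x* = b. -/
/-- structural fact behind Proposition 4: for a continuous,
componentwise-antitone constraint function `f`, a minimizer `x*` of the total
power over `S = {x | b ≤ x ∧ f x ≤ ε}` with inactive outage constraint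
(`f x* < ε`) must equal the lower bound `b`. -/
theorem minimizer_on_boundary
    (n : ℕ) (hn : 1 ≤ n)
    (f : (Fin n → ℝ) → ℝ) (hf : Continuous f) (hanti : Antitone f)
    (b : Fin n → ℝ) (ε : ℝ)
    (xstar : Fin n → ℝ)
    (hxb : ∀ i, b i ≤ xstar i) (hxf : f xstar ≤ ε)
    (hmin : ∀ y : Fin n → ℝ, (∀ i, b i ≤ y i) → f y ≤ ε →
      ∑ i, xstar i ≤ ∑ i, y i)
    (hstrict : f xstar < ε) :
    xstar = b := by
  have hcont : Continuous fun t : ℝ => f (xstar + t • (b - xstar)) := by fun_prop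
  have hev : ∀ᶠ t in nhdsWithin (0 : ℝ) (Set.Ioi 0), f (xstar + t • (b - xstar)) < ε :=
    ((hcont.tendsto 0).eventually_lt_const (by simpa using hstrict)).filter_mono
      nhdsWithin_le_nhds
  obtain ⟨t, hft, ht0, ht1⟩ := (hev.and (Ioo_mem_nhdsGT (zero_lt_one' ℝ))).exists
  have hsum := hmin (xstar + t • (b - xstar))
    (fun i => by
      simp only [Pi.add_apply, Pi.smul_apply, Pi.sub_apply, smul_eq_mul]
      nlinarith [hxb i]) hft.le
  simp only [Pi.add_apply, Pi.smul_apply, Pi.sub_apply, smul_eq_mul,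
    Finset.sum_add_distrib, ← Finset.mul_sum, Finset.sum_sub_distrib] at hsum
  have hle : ∑ i, xstar i ≤ ∑ i, b i :=
    sub_nonneg.1 (nonneg_of_mul_nonneg_right (by linarith) ht0)
  have heq := (Finset.sum_eq_sum_iff_of_le fun i _ => hxb i).1
    (le_antisymm (Finset.sum_le_sum fun i _ => hxb i) hle)
  exact funext fun i => (heq i (Finset.mem_univ i)).symm
end
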